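/- arXiv:2203.03403 — 7 statements merged into one kernel-verified Lean document; each statement's English description precedes it below -/
import Mathlib

section
/- Let g be a Lie algebra over a field K of characteristic 0 and let R : g → g be a linear map satisfying the Rota-Baxter identity [R x, R y] = R([R x, y] + [x, R y]) for all x, y ∈ g. Then the bilinear product x ∗ y := [R x, y] satisfies the pre-Lie (left-symmetry) identity (x ∗ y) ∗ z − x ∗ (y ∗ z) = (y ∗ x) ∗ z − y ∗ (x ∗ z) for all x, y, z ∈ g. -/
/-- If `R` is a Rota-Baxter operator on a Lie algebra `g`, then
`x ∗ y := ⁅R x, y⁆` satisfies the pre-Lie (left-symmetry) identity. -/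
theorem rotaBaxter_preLie {K : Type*} [Field K] [CharZero K]
    {g : Type*} [LieRing g] [LieAlgebra K g] (R : g →ₗ[K] g)
    (hR : ∀ x y : g, ⁅R x, R y⁆ = R (⁅R x, y⁆ + ⁅x, R y⁆)) :
    ∀ x y z : g,
      ⁅R ⁅R x, y⁆, z⁆ - ⁅R x, ⁅R y, z⁆⁆ =
        ⁅R ⁅R y, x⁆, z⁆ - ⁅R y, ⁅R x, z⁆⁆ := by
  intro x y z
  have h : ⁅⁅R x, R y⁆, z⁆ = ⁅R ⁅R x, y⁆, z⁆ - ⁅R ⁅R y, x⁆, z⁆ := by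
    rw [hR, ← lie_skew x (R y), map_add, map_neg, add_lie, neg_lie, sub_eq_add_neg]
  rw [lie_lie] at h
  rw [sub_eq_sub_iff_sub_eq_sub, h]
end

section
/- Let g be a Lie algebra over a field K of characteristic 0 with Rota-Baxter operator R, and let (V, ρ, 𝓡) be a representation of the Rota-Baxter Lie algebra (g, R). Define ρ*(x) : V* → V* by (ρ*(x)ξ)(v) = −ξ(ρ(x)v), and let 𝓡* : V* → V* be the transpose of 𝓡, (𝓡*ξ)(v) = ξ(𝓡 v). Then ρ* is a Lie algebra representation of g on the dual space V*, and (V*, ρ*, −𝓡*) is a representation of the Rota-Baxter Lie algebra (g, R); that is, ρ*(R x)∘(−𝓡*) = (−𝓡*)∘ρ*(R x) + (−𝓡*)∘ρ*(x)∘(−𝓡*) for all x ∈ g. -/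
/-- the dual representation of a representation of a Rota-Baxter Lie
algebra.  If `(V, ρ, Q)` is a representation of `(g, R)`, then `ρ* x := -(ρ x)ᵀ`
together with `-Qᵀ` is a representation of `(g, R)` on the dual space `V*`. -/
theorem dual_rep_rotaBaxter {K : Type*} [Field K] [CharZero K]
    {g : Type*} [LieRing g] [LieAlgebra K g]
    {V : Type*} [AddCommGroup V] [Module K V]
    (R : g →ₗ[K] g)
    (hR : ∀ x y : g, ⁅R x, R y⁆ = R (⁅R x, y⁆ + ⁅x, R y⁆))
    (ρ : g →ₗ[K] V →ₗ[K] V) (Q : V →ₗ[K] V)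
    (hrep : ∀ x y : g, ρ ⁅x, y⁆ = ρ x ∘ₗ ρ y - ρ y ∘ₗ ρ x)
    (hrb : ∀ x : g, ρ (R x) ∘ₗ Q = Q ∘ₗ ρ (R x) + Q ∘ₗ (ρ x ∘ₗ Q)) :
    (∀ x y : g,
      (-(ρ ⁅x, y⁆).dualMap : Module.Dual K V →ₗ[K] Module.Dual K V) =
        (-(ρ x).dualMap) ∘ₗ (-(ρ y).dualMap) - (-(ρ y).dualMap) ∘ₗ (-(ρ x).dualMap)) ∧
    (∀ x : g,
      (-(ρ (R x)).dualMap) ∘ₗ (-Q.dualMap) =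
        (-Q.dualMap) ∘ₗ (-(ρ (R x)).dualMap) +
          (-Q.dualMap) ∘ₗ ((-(ρ x).dualMap) ∘ₗ (-Q.dualMap))) := by
  refine ⟨fun x y => ?_, fun x => ?_⟩
  · ext ξ v
    simp [hrep]
  · ext ξ v
    have h := congrArg ξ (LinearMap.congr_fun (hrb x) v)
    simp only [LinearMap.comp_apply, LinearMap.add_apply, map_add] at h
    simp [h]
end

section
/- Let g be a Lie algebra over a field K of characteristic 0 with Rota-Baxter operator R, and let (V, ρ, 𝓡) be a representation of the Rota-Baxter Lie algebra (g, R). Then the bracket on g × V defined by [(x,u),(y,v)] := ([x,y], ρ(x)v − ρ(y)u) is a Lie bracket (bilinear, skew-symmetric, satisfying the Jacobi identity), and the linear map 𝔯(x,u) := (R x, 𝓡 u) is a Rota-Baxter operator for this bracket, i.e. [𝔯(x,u), 𝔯(y,v)] = 𝔯([𝔯(x,u),(y,v)] + [(x,u),𝔯(y,v)]). -/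
/-- The semidirect product bracket on `g × V` coming from a representation `ρ`. -/
def sdBracket {K : Type*} [Field K] {g V : Type*} [LieRing g] [LieAlgebra K g]
    [AddCommGroup V] [Module K V] (ρ : g →ₗ[K] V →ₗ[K] V) (p q : g × V) : g × V :=
  (⁅p.1, q.1⁆, ρ p.1 q.2 - ρ q.1 p.2)

/-- the semidirect product of a Rota-Baxter Lie algebra with a
representation.  The semidirect product bracket is a Lie bracket on `g × V` and
`(x, u) ↦ (R x, Q u)` is a Rota-Baxter operator for it. -/
theorem semidirect_rotaBaxter {K : Type*} [Field K] [CharZero K]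
    {g : Type*} [LieRing g] [LieAlgebra K g]
    {V : Type*} [AddCommGroup V] [Module K V]
    (R : g →ₗ[K] g)
    (hR : ∀ x y : g, ⁅R x, R y⁆ = R (⁅R x, y⁆ + ⁅x, R y⁆))
    (ρ : g →ₗ[K] V →ₗ[K] V) (Q : V →ₗ[K] V)
    (hrep : ∀ x y : g, ρ ⁅x, y⁆ = ρ x ∘ₗ ρ y - ρ y ∘ₗ ρ x)
    (hrb : ∀ x : g, ρ (R x) ∘ₗ Q = Q ∘ₗ ρ (R x) + Q ∘ₗ (ρ x ∘ₗ Q)) :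
    (∀ (a : K) (p q r : g × V),
      sdBracket ρ (a • p + q) r = a • sdBracket ρ p r + sdBracket ρ q r) ∧
    (∀ (a : K) (p q r : g × V),
      sdBracket ρ p (a • q + r) = a • sdBracket ρ p q + sdBracket ρ p r) ∧
    (∀ p q : g × V, sdBracket ρ p q = - sdBracket ρ q p) ∧
    (∀ p q r : g × V,
      sdBracket ρ p (sdBracket ρ q r) + sdBracket ρ r (sdBracket ρ p q) +
        sdBracket ρ q (sdBracket ρ r p) = 0) ∧
    (∀ p q : g × V,
      sdBracket ρ (R p.1, Q p.2) (R q.1, Q q.2) =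
        (R (sdBracket ρ (R p.1, Q p.2) q + sdBracket ρ p (R q.1, Q q.2)).1,
         Q (sdBracket ρ (R p.1, Q p.2) q + sdBracket ρ p (R q.1, Q q.2)).2)) := by
  refine ⟨?_, ?_, ?_, ?_, ?_⟩
  · rintro a ⟨x, u⟩ ⟨y, v⟩ ⟨z, w⟩
    ext
    · simp [sdBracket]
    · simp only [sdBracket, Prod.smul_mk, Prod.mk_add_mk, map_add, map_smul,
        LinearMap.add_apply, LinearMap.smul_apply, smul_sub]
      abel
  · rintro a ⟨x, u⟩ ⟨y, v⟩ ⟨z, w⟩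
    ext
    · simp [sdBracket]
    · simp only [sdBracket, Prod.smul_mk, Prod.mk_add_mk, map_add, map_smul,
        LinearMap.add_apply, LinearMap.smul_apply, smul_sub]
      abel
  · rintro ⟨x, u⟩ ⟨y, v⟩
    ext <;> simp [sdBracket]
  · rintro ⟨x, u⟩ ⟨y, v⟩ ⟨z, w⟩
    ext
    · simp only [sdBracket, Prod.mk_add_mk, Prod.fst_zero]
      rw [add_right_comm]
      exact lie_jacobi x y z
    · simp only [sdBracket, Prod.mk_add_mk, Prod.snd_zero, hrep, map_sub,
        LinearMap.sub_apply, LinearMap.comp_apply]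
      abel
  · rintro ⟨x, u⟩ ⟨y, v⟩
    have hx := LinearMap.congr_fun (hrb x) v
    have hy := LinearMap.congr_fun (hrb y) u
    simp only [LinearMap.comp_apply, LinearMap.add_apply] at hx hy
    ext
    · exact hR x y
    · simp only [sdBracket, Prod.mk_add_mk, map_add, map_sub, hx, hy]
      abel
end

section
/- Let ((g₁,[·,·]₁,T₁),(g₀,[·,·]₀,T₀),∂,ρ) be a crossed module of Rota-Baxter Lie algebras. Then the bracket on g₀ × g₁ defined by [(x,u),(y,v)] := ([x,y]₀, ρ(x)v − ρ(y)u + [u,v]₁) is a Lie bracket (bilinear, skew-symmetric, satisfying the Jacobi identity), and T(x,u) := (T₀ x, T₁ u) is a Rota-Baxter operator for this bracket, i.e. [T(x,u), T(y,v)] = T([T(x,u),(y,v)] + [(x,u),T(y,v)]). -/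
/-- The bracket on `g₀ × g₁` coming from a crossed module structure:
`[(x,u),(y,v)] = ([x,y]₀, ρ(x)v − ρ(y)u + [u,v]₁)`. -/
def cmBracket {K : Type*} [Field K] {g0 g1 : Type*}
    [LieRing g0] [LieAlgebra K g0] [LieRing g1] [LieAlgebra K g1]
    (ρ : g0 →ₗ[K] g1 →ₗ[K] g1) (p q : g0 × g1) : g0 × g1 :=
  (⁅p.1, q.1⁆, ρ p.1 q.2 - ρ q.1 p.2 + ⁅p.2, q.2⁆)

/-- for a crossed module of Rota-Baxter Lie algebras, the bracket
`[(x,u),(y,v)] = ([x,y]₀, ρ(x)v − ρ(y)u + [u,v]₁)` on `g₀ × g₁` is a Lie bracket and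
`T(x,u) = (T₀ x, T₁ u)` is a Rota-Baxter operator for it. -/
theorem crossedModule_rotaBaxter_product {K : Type*} [Field K] [CharZero K]
    {g0 : Type*} [LieRing g0] [LieAlgebra K g0]
    {g1 : Type*} [LieRing g1] [LieAlgebra K g1]
    (T0 : g0 →ₗ[K] g0) (T1 : g1 →ₗ[K] g1)
    (hT0 : ∀ x y : g0, ⁅T0 x, T0 y⁆ = T0 (⁅T0 x, y⁆ + ⁅x, T0 y⁆))
    (hT1 : ∀ u v : g1, ⁅T1 u, T1 v⁆ = T1 (⁅T1 u, v⁆ + ⁅u, T1 v⁆))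
    (δ : g1 →ₗ⁅K⁆ g0) (hδT : ∀ u : g1, δ (T1 u) = T0 (δ u))
    (ρ : g0 →ₗ[K] g1 →ₗ[K] g1)
    (hrep : ∀ (x y : g0) (u : g1), ρ ⁅x, y⁆ u = ρ x (ρ y u) - ρ y (ρ x u))
    (hder : ∀ (x : g0) (u v : g1), ρ x ⁅u, v⁆ = ⁅ρ x u, v⁆ + ⁅u, ρ x v⁆)
    (hRBrep : ∀ (x : g0) (u : g1),
      ρ (T0 x) (T1 u) = T1 (ρ (T0 x) u) + T1 (ρ x (T1 u)))
    (hcm1 : ∀ (x : g0) (u : g1), δ (ρ x u) = ⁅x, δ u⁆)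
    (hcm2 : ∀ u v : g1, ρ (δ u) v = ⁅u, v⁆) :
    (∀ (a : K) (p q r : g0 × g1),
      cmBracket ρ (a • p + q) r = a • cmBracket ρ p r + cmBracket ρ q r) ∧
    (∀ (a : K) (p q r : g0 × g1),
      cmBracket ρ p (a • q + r) = a • cmBracket ρ p q + cmBracket ρ p r) ∧
    (∀ p q : g0 × g1, cmBracket ρ p q = - cmBracket ρ q p) ∧
    (∀ p q r : g0 × g1,
      cmBracket ρ p (cmBracket ρ q r) + cmBracket ρ r (cmBracket ρ p q) +
        cmBracket ρ q (cmBracket ρ r p) = 0) ∧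
    (∀ p q : g0 × g1,
      cmBracket ρ (T0 p.1, T1 p.2) (T0 q.1, T1 q.2) =
        (T0 (cmBracket ρ (T0 p.1, T1 p.2) q + cmBracket ρ p (T0 q.1, T1 q.2)).1,
         T1 (cmBracket ρ (T0 p.1, T1 p.2) q + cmBracket ρ p (T0 q.1, T1 q.2)).2)) := by
  refine ⟨?_, ?_, ?_, ?_, ?_⟩
  · rintro a ⟨x, u⟩ ⟨y, v⟩ ⟨z, w⟩
    ext
    · simp [cmBracket]
    · simp only [cmBracket, Prod.fst_add, Prod.snd_add, Prod.smul_fst, Prod.smul_snd, map_add,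
        map_smul, LinearMap.add_apply, LinearMap.smul_apply, add_lie, smul_lie]
      module
  · rintro a ⟨x, u⟩ ⟨y, v⟩ ⟨z, w⟩
    ext
    · simp [cmBracket]
    · simp only [cmBracket, Prod.fst_add, Prod.snd_add, Prod.smul_fst, Prod.smul_snd, map_add,
        map_smul, LinearMap.add_apply, LinearMap.smul_apply, lie_add, lie_smul]
      module
  · rintro ⟨x, u⟩ ⟨y, v⟩
    ext
    · simp [cmBracket]
    · simp only [cmBracket, Prod.snd_neg, ← lie_skew u v]
      abel
  · rintro ⟨x, u⟩ ⟨y, v⟩ ⟨z, w⟩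
    ext
    · simp only [cmBracket, Prod.fst_add, Prod.fst_zero]
      rw [add_right_comm]
      exact lie_jacobi x y z
    · have hjac : ⁅w, ⁅u, v⁆⁆ = -⁅u, ⁅v, w⁆⁆ - ⁅v, ⁅w, u⁆⁆ := by
        rw [eq_sub_iff_add_eq, eq_neg_iff_add_eq_zero, ← lie_jacobi u v w]
        abel
      simp only [cmBracket, Prod.snd_add, Prod.snd_zero, map_add, map_sub, hrep, hder,
        lie_add, lie_sub, hjac]
      rw [← lie_skew (ρ x v) w, ← lie_skew (ρ y w) u, ← lie_skew (ρ z u) v]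
      abel
  · rintro ⟨x, u⟩ ⟨y, v⟩
    ext
    · exact hT0 x y
    · simp only [cmBracket, Prod.snd_add, hRBrep, hT1, map_add, map_sub]
      abel
end

section
/- Let ((g₁,[·,·]₁),(g₀,[·,·]₀),∂,ρ) be a crossed module of Lie algebras over a field K of characteristic 0, and equip g₀ × g₁ with the Lie bracket [(x,u),(y,v)] := ([x,y]₀, ρ(x)v − ρ(y)u + [u,v]₁). Let T₀ : g₀ → g₀ and T₁ : g₁ → g₁ be linear maps and define T(x,u) := (T₀ x, T₁ u). Then T is a Rota-Baxter operator on this Lie algebra if and only if T₀ is a Rota-Baxter operator on g₀, T₁ is a Rota-Baxter operator on g₁, and T₁(ρ(T₀ x)u + ρ(x)(T₁ u)) = ρ(T₀ x)(T₁ u) for all x ∈ g₀ and u ∈ g₁. -/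
/-- for a crossed module of Lie algebras and linear maps `T₀, T₁`,
the map `T(x,u) = (T₀ x, T₁ u)` is a Rota-Baxter operator on `g₀ × g₁` (with the
crossed-module bracket) iff `T₀` and `T₁` are Rota-Baxter operators and
`T₁(ρ(T₀ x)u + ρ(x)(T₁ u)) = ρ(T₀ x)(T₁ u)`. -/
theorem rotaBaxter_product_iff {K : Type*} [Field K] [CharZero K]
    {g0 : Type*} [LieRing g0] [LieAlgebra K g0]
    {g1 : Type*} [LieRing g1] [LieAlgebra K g1]
    (δ : g1 →ₗ⁅K⁆ g0)
    (ρ : g0 →ₗ[K] g1 →ₗ[K] g1)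
    (hrep : ∀ (x y : g0) (u : g1), ρ ⁅x, y⁆ u = ρ x (ρ y u) - ρ y (ρ x u))
    (hder : ∀ (x : g0) (u v : g1), ρ x ⁅u, v⁆ = ⁅ρ x u, v⁆ + ⁅u, ρ x v⁆)
    (hcm1 : ∀ (x : g0) (u : g1), δ (ρ x u) = ⁅x, δ u⁆)
    (hcm2 : ∀ u v : g1, ρ (δ u) v = ⁅u, v⁆)
    (T0 : g0 →ₗ[K] g0) (T1 : g1 →ₗ[K] g1) :
    (∀ p q : g0 × g1,
      cmBracket ρ (T0 p.1, T1 p.2) (T0 q.1, T1 q.2) =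
        (T0 (cmBracket ρ (T0 p.1, T1 p.2) q + cmBracket ρ p (T0 q.1, T1 q.2)).1,
         T1 (cmBracket ρ (T0 p.1, T1 p.2) q + cmBracket ρ p (T0 q.1, T1 q.2)).2)) ↔
    ((∀ x y : g0, ⁅T0 x, T0 y⁆ = T0 (⁅T0 x, y⁆ + ⁅x, T0 y⁆)) ∧
     (∀ u v : g1, ⁅T1 u, T1 v⁆ = T1 (⁅T1 u, v⁆ + ⁅u, T1 v⁆)) ∧
     (∀ (x : g0) (u : g1), T1 (ρ (T0 x) u + ρ x (T1 u)) = ρ (T0 x) (T1 u))) := by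
  constructor
  · intro h
    refine ⟨fun x y => ?_, fun u v => ?_, fun x u => ?_⟩
    · simpa [cmBracket] using congrArg Prod.fst (h (x, 0) (y, 0))
    · simpa [cmBracket] using congrArg Prod.snd (h (0, u) (0, v))
    · simpa [cmBracket] using (congrArg Prod.snd (h (x, 0) (0, u))).symm
  · rintro ⟨h0, h1, h2⟩ ⟨x, u⟩ ⟨y, v⟩
    refine Prod.ext (h0 x y) ?_
    simp only [cmBracket, Prod.snd_add, h1, ← h2, map_add, map_sub]
    abel
end

section
/- Let (g₀, g₁, l₁, l₂, R₀, R₁) be a strict 2-term Rota-Baxter L∞-algebra. Define [u,v]₁ := l₂(l₁ u, v) for u, v ∈ g₁. Then [·,·]₁ is a Lie bracket on g₁ (bilinear, skew-symmetric, satisfying the Jacobi identity), and R₁ is a Rota-Baxter operator for this bracket, i.e. [R₁ u, R₁ v]₁ = R₁([R₁ u, v]₁ + [u, R₁ v]₁) for all u, v ∈ g₁. -/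
/-- in a strict 2-term Rota-Baxter `L∞`-algebra, the bracket
`[u,v]₁ := l₂(l₁ u, v)` is a Lie bracket on `g₁` and `R₁` is a Rota-Baxter
operator for it.  Here `l2₀ : g₀ × g₀ → g₀` and `l2₁ : g₀ × g₁ → g₁` are the
two components of `l₂`, with the convention `l₂(u,x) := −l₂(x,u)`. -/
theorem strict2term_g1_rotaBaxterLie {K : Type*} [Field K] [CharZero K]
    {g0 : Type*} [AddCommGroup g0] [Module K g0]
    {g1 : Type*} [AddCommGroup g1] [Module K g1]
    (l1 : g1 →ₗ[K] g0)
    (l2₀ : g0 →ₗ[K] g0 →ₗ[K] g0) (l2₁ : g0 →ₗ[K] g1 →ₗ[K] g1)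
    (R0 : g0 →ₗ[K] g0) (R1 : g1 →ₗ[K] g1)
    (hskew : ∀ x y : g0, l2₀ x y = - l2₀ y x)
    (hcomm : ∀ u : g1, l1 (R1 u) = R0 (l1 u))
    (ha1 : ∀ (x : g0) (u : g1), l1 (l2₁ x u) = l2₀ x (l1 u))
    (ha2 : ∀ u v : g1, l2₁ (l1 u) v = - l2₁ (l1 v) u)
    (hb : ∀ x y z : g0, l2₀ x (l2₀ y z) + l2₀ z (l2₀ x y) + l2₀ y (l2₀ z x) = 0)
    (hc : ∀ (x y : g0) (u : g1),
      l2₁ x (l2₁ y u) + (-(l2₁ (l2₀ x y) u)) + l2₁ y (-(l2₁ x u)) = 0)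
    (hi : ∀ x y : g0, R0 (l2₀ (R0 x) y + l2₀ x (R0 y)) = l2₀ (R0 x) (R0 y))
    (hii : ∀ (x : g0) (u : g1),
      R1 ((-(l2₁ x (R1 u))) + (-(l2₁ (R0 x) u))) = -(l2₁ (R0 x) (R1 u))) :
    (∀ (a : K) (u u' v : g1),
      l2₁ (l1 (a • u + u')) v = a • l2₁ (l1 u) v + l2₁ (l1 u') v) ∧
    (∀ (a : K) (u v v' : g1),
      l2₁ (l1 u) (a • v + v') = a • l2₁ (l1 u) v + l2₁ (l1 u) v') ∧
    (∀ u v : g1, l2₁ (l1 u) v = - l2₁ (l1 v) u) ∧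
    (∀ u v w : g1,
      l2₁ (l1 u) (l2₁ (l1 v) w) + l2₁ (l1 w) (l2₁ (l1 u) v) +
        l2₁ (l1 v) (l2₁ (l1 w) u) = 0) ∧
    (∀ u v : g1,
      l2₁ (l1 (R1 u)) (R1 v) =
        R1 (l2₁ (l1 (R1 u)) v + l2₁ (l1 u) (R1 v))) := by
  refine ⟨fun a u u' v => by simp, fun a u v v' => by simp, ha2, fun u v w => ?_, fun u v => ?_⟩
  · rw [ha2 w (l2₁ (l1 u) v), ha1, ha2 w u]
    exact hc (l1 u) (l1 v) w
  · rw [hcomm, ← neg_inj, ← hii, ← map_neg R1, neg_add_rev]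
end

section
/- Let ((g₁,[·,·]₁,T₁),(g₀,[·,·]₀,T₀),∂,ρ) be a crossed module of Rota-Baxter Lie algebras. Define [x,y]_{T₀} := [T₀ x, y]₀ + [x, T₀ y]₀, [u,v]_{T₁} := [T₁ u, v]₁ + [u, T₁ v]₁, and ρ_T(x)u := ρ(T₀ x)u + ρ(x)(T₁ u). Then ρ_T is a representation of the Lie algebra (g₀, [·,·]_{T₀}) on g₁ acting by derivations of [·,·]_{T₁}; that is, ρ_T([x,y]_{T₀}) = ρ_T(x)∘ρ_T(y) − ρ_T(y)∘ρ_T(x) and ρ_T(x)[u,v]_{T₁} = [ρ_T(x)u, v]_{T₁} + [u, ρ_T(x)v]_{T₁} for all x, y ∈ g₀ and u, v ∈ g₁. -/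
/-- with `[x,y]_{T₀} = [T₀x,y]₀ + [x,T₀y]₀`,
`[u,v]_{T₁} = [T₁u,v]₁ + [u,T₁v]₁` and `ρ_T(x)u = ρ(T₀x)u + ρ(x)(T₁u)`, the map
`ρ_T` is a representation of `(g₀, [·,·]_{T₀})` on `g₁` acting by derivations of
`[·,·]_{T₁}`. -/
theorem crossedModule_rhoT_rep_derivation {K : Type*} [Field K] [CharZero K]
    {g0 : Type*} [LieRing g0] [LieAlgebra K g0]
    {g1 : Type*} [LieRing g1] [LieAlgebra K g1]
    (T0 : g0 →ₗ[K] g0) (T1 : g1 →ₗ[K] g1)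
    (hT0 : ∀ x y : g0, ⁅T0 x, T0 y⁆ = T0 (⁅T0 x, y⁆ + ⁅x, T0 y⁆))
    (hT1 : ∀ u v : g1, ⁅T1 u, T1 v⁆ = T1 (⁅T1 u, v⁆ + ⁅u, T1 v⁆))
    (δ : g1 →ₗ⁅K⁆ g0) (hδT : ∀ u : g1, δ (T1 u) = T0 (δ u))
    (ρ : g0 →ₗ[K] g1 →ₗ[K] g1)
    (hrep : ∀ (x y : g0) (u : g1), ρ ⁅x, y⁆ u = ρ x (ρ y u) - ρ y (ρ x u))
    (hder : ∀ (x : g0) (u v : g1), ρ x ⁅u, v⁆ = ⁅ρ x u, v⁆ + ⁅u, ρ x v⁆)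
    (hRBrep : ∀ (x : g0) (u : g1),
      ρ (T0 x) (T1 u) = T1 (ρ (T0 x) u) + T1 (ρ x (T1 u)))
    (hcm1 : ∀ (x : g0) (u : g1), δ (ρ x u) = ⁅x, δ u⁆)
    (hcm2 : ∀ u v : g1, ρ (δ u) v = ⁅u, v⁆) :
    (∀ (x y : g0) (u : g1),
      (ρ (T0 (⁅T0 x, y⁆ + ⁅x, T0 y⁆)) u + ρ (⁅T0 x, y⁆ + ⁅x, T0 y⁆) (T1 u)) =
        (ρ (T0 x) (ρ (T0 y) u + ρ y (T1 u)) + ρ x (T1 (ρ (T0 y) u + ρ y (T1 u)))) -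
        (ρ (T0 y) (ρ (T0 x) u + ρ x (T1 u)) + ρ y (T1 (ρ (T0 x) u + ρ x (T1 u))))) ∧
    (∀ (x : g0) (u v : g1),
      ρ (T0 x) (⁅T1 u, v⁆ + ⁅u, T1 v⁆) + ρ x (T1 (⁅T1 u, v⁆ + ⁅u, T1 v⁆)) =
        (⁅T1 (ρ (T0 x) u + ρ x (T1 u)), v⁆ + ⁅ρ (T0 x) u + ρ x (T1 u), T1 v⁆) +
        (⁅T1 u, ρ (T0 x) v + ρ x (T1 v)⁆ + ⁅u, T1 (ρ (T0 x) v + ρ x (T1 v))⁆)) := by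
  refine ⟨fun x y u => ?_, fun x u v => ?_⟩
  · rw [← hT0]
    simp only [map_add, LinearMap.add_apply, hrep, hRBrep]
    abel
  · rw [← hT1, map_add T1 (ρ (T0 x) u), ← hRBrep, map_add T1 (ρ (T0 x) v), ← hRBrep]
    simp only [map_add, hder, lie_add, add_lie]
    abel
end
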